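/- The set ℰ = {y ∈ ℝ : y > 1 and limsup_{N→∞} f_N(y)/log N = ∞} is Lebesgue measurable and has Lebesgue measure zero. -/

import Mathlib

open MeasureTheory Filter

/-- `cnt N d a y` is the number of positive integers `k ≤ log N / log y`
with `⌊y^k⌋ ≡ a (mod d)`. -/
noncomputable def cnt (N d a : ℕ) (y : ℝ) : ℕ :=
  Nat.card {k : ℕ | 1 ≤ k ∧ (k : ℝ) ≤ Real.log N / Real.log y ∧
    ⌊y ^ k⌋ ≡ (a : ℤ) [ZMOD (d : ℤ)]}

/-- `fN N y = Σ_{d=1}^{N} (1/d) · max_{1 ≤ a ≤ d} #{k ≥ 1 : k ≤ log N / log y,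
⌊y^k⌋ ≡ a (mod d)}`. -/
noncomputable def fN (N : ℕ) (y : ℝ) : ℝ :=
  ∑ d ∈ Finset.Icc 1 N, (1 / (d : ℝ)) * (((Finset.Icc 1 d).sup (fun a => cnt N d a y) : ℕ) : ℝ)

/-- `f y = limsup_{N→∞} fN N y / log N`, with values in `[0, ∞]`. -/
noncomputable def f (y : ℝ) : ENNReal :=
  Filter.limsup (fun N : ℕ => ENNReal.ofReal (fN N y / Real.log N)) Filter.atTop



lemma piece_anti (φ : ℝ → ℝ) (hc : ConvexOn ℝ (Set.Ici 1) φ) (hm : StrictMonoOn φ (Set.Ici 1))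
    (hcont : Continuous φ) (α β : ℝ) (hα : 1 ≤ α) (m : ℤ) (h0 : φ α ≤ m) :
    volume {y : ℝ | y ∈ Set.Ico α β ∧ ⌊φ y⌋ = m + 1} ≤
      volume {y : ℝ | y ∈ Set.Ico α β ∧ ⌊φ y⌋ = m} := by
  by_cases hne : ∃ y, y ∈ Set.Ico α β ∧ ⌊φ y⌋ = m + 1
  swap
  · have : {y : ℝ | y ∈ Set.Ico α β ∧ ⌊φ y⌋ = m + 1} = ∅ := by
      exact Set.eq_empty_of_forall_notMem fun y h => hne ⟨y, h⟩
    rw [this]; simp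
  obtain ⟨y0, hy0, hy0m⟩ := hne
  have hy0' := Int.floor_eq_iff.1 hy0m
  push_cast at hy0'
  obtain ⟨p, hp, hpm⟩ := intermediate_value_Icc hy0.1 hcont.continuousOn
    (show (m:ℝ) ∈ Set.Icc (φ α) (φ y0) from ⟨h0, by linarith⟩)
  obtain ⟨q, hq, hqm⟩ := intermediate_value_Icc hp.2 hcont.continuousOn
    (show (m:ℝ)+1 ∈ Set.Icc (φ p) (φ y0) from ⟨by linarith, by linarith⟩)
  have hp1 : (1:ℝ) ≤ p := hα.trans hp.1
  have hq1 : (1:ℝ) ≤ q := hp1.trans hq.1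
  have hr1 : (1:ℝ) ≤ 2 * q - p := by linarith [hq.1]
  have hmid : (m:ℝ) + 2 ≤ φ (2 * q - p) := by
    have := hc.2 (show p ∈ Set.Ici (1:ℝ) from hp1) (show 2*q-p ∈ Set.Ici (1:ℝ) from hr1)
      (show (0:ℝ) ≤ 1/2 by norm_num) (show (0:ℝ) ≤ 1/2 by norm_num) (by norm_num)
    simp only [smul_eq_mul] at this
    rw [show 1/2 * p + 1/2 * (2*q-p) = q by ring] at this
    linarith
  have h1 : {y : ℝ | y ∈ Set.Ico α β ∧ ⌊φ y⌋ = m + 1} ⊆ Set.Ico q (2 * q - p) := by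
    rintro y ⟨hy, hym⟩
    have h2 := Int.floor_eq_iff.1 hym
    push_cast at h2
    have hy1 : y ∈ Set.Ici (1:ℝ) := hα.trans hy.1
    constructor
    · exact (hm.le_iff_le (show q ∈ Set.Ici (1:ℝ) from hq1) hy1).1 (by linarith)
    · exact (hm.lt_iff_lt hy1 (show 2*q-p ∈ Set.Ici (1:ℝ) from hr1)).1 (by linarith)
  have h2 : Set.Ico p q ⊆ {y : ℝ | y ∈ Set.Ico α β ∧ ⌊φ y⌋ = m} := by
    intro y hy
    have hy1 : y ∈ Set.Ici (1:ℝ) := hp1.trans hy.1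
    refine ⟨⟨hp.1.trans hy.1, hy.2.trans_le (hq.2.trans hy0.2.le)⟩, Int.floor_eq_iff.2 ⟨?_, ?_⟩⟩
    · rw [← hpm]; exact (hm.le_iff_le (show p ∈ Set.Ici (1:ℝ) from hp1) hy1).2 hy.1
    · rw [← hqm]; exact (hm.lt_iff_lt hy1 (show q ∈ Set.Ici (1:ℝ) from hq1)).2 hy.2
  refine (measure_mono h1).trans (le_trans ?_ (measure_mono h2))
  rw [Real.volume_Ico, Real.volume_Ico]
  exact le_of_eq (by ring_nf)

lemma spacing (φ : ℝ → ℝ) (hc : ConvexOn ℝ (Set.Ici 1) φ) (hm : StrictMonoOn φ (Set.Ici 1))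
    (hcont : Continuous φ) (α β : ℝ) (hα : 1 ≤ α) (c : ℤ) (h0 : φ α ≤ c) (d : ℕ) (hd : 1 ≤ d) :
    (d : ENNReal) * volume {y : ℝ | y ∈ Set.Ico α β ∧ c ≤ ⌊φ y⌋ ∧ ⌊φ y⌋ ≡ c - 1 [ZMOD d]} ≤
      ENNReal.ofReal (β - α) := by
  set T : ℤ → Set ℝ := fun m => {y : ℝ | y ∈ Set.Ico α β ∧ ⌊φ y⌋ = m} with hT
  have hmeas : ∀ m, MeasurableSet (T m) := fun m =>
    measurableSet_Ico.inter ((Int.measurable_floor.comp hcont.measurable) (measurableSet_singleton m))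
  have hanti : ∀ m : ℤ, c ≤ m → ∀ i : ℕ, volume (T (m + i)) ≤ volume (T m) := by
    intro m hcm i
    induction i with
    | zero => simp
    | succ i ih =>
      refine le_trans ?_ ih
      have := piece_anti φ hc hm hcont α β hα (m + i) (h0.trans (by exact_mod_cast (by omega : c ≤ m + i)))
      simpa [hT, add_assoc] using this
  have hsub : {y : ℝ | y ∈ Set.Ico α β ∧ c ≤ ⌊φ y⌋ ∧ ⌊φ y⌋ ≡ c - 1 [ZMOD d]} ⊆
      ⋃ j : ℕ, T (c + j * d + (d - 1 : ℕ)) := by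
    rintro y ⟨hy, hcy, hmod⟩
    obtain ⟨t, ht⟩ := hmod.symm.dvd
    have ht1 : 1 ≤ t := by
      by_contra h
      have : t ≤ 0 := by omega
      have : (d:ℤ) * t ≤ 0 := mul_nonpos_of_nonneg_of_nonpos (by positivity) this
      omega
    refine Set.mem_iUnion.2 ⟨(t - 1).toNat, hy, ?_⟩
    have h1 : (((t-1).toNat : ℕ) : ℤ) = t - 1 := Int.toNat_of_nonneg (by omega)
    rw [h1, Nat.cast_sub hd]
    push_cast
    linarith
  have hpair : Pairwise (Function.onFun Disjoint fun x : ℕ × Fin d => T (c + x.1 * d + (x.2 : ℕ))) := by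
    rintro ⟨j, i⟩ ⟨j', i'⟩ hne
    rw [Function.onFun, Set.disjoint_left]
    rintro y ⟨_, h1⟩ ⟨_, h2⟩
    apply hne
    have h3 : (j * d + i : ℕ) = j' * d + i' := by
      have := h1.symm.trans h2
      simp only at this
      zify; linarith
    have hi : (i:ℕ) = i' := by
      have := congrArg (· % d) h3
      simpa [Nat.mod_eq_of_lt i.2, Nat.mod_eq_of_lt i'.2] using this
    have hj : j = j' := by
      rw [hi] at h3
      exact Nat.eq_of_mul_eq_mul_right hd (by omega)
    exact Prod.ext hj (Fin.ext hi)
  calc (d : ENNReal) * volume {y : ℝ | y ∈ Set.Ico α β ∧ c ≤ ⌊φ y⌋ ∧ ⌊φ y⌋ ≡ c - 1 [ZMOD d]}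
      ≤ d * ∑' j : ℕ, volume (T (c + j * d + (d - 1 : ℕ))) := by
        gcongr
        exact (measure_mono hsub).trans (measure_iUnion_le _)
    _ = ∑' j : ℕ, d * volume (T (c + j * d + (d - 1 : ℕ))) := ENNReal.tsum_mul_left.symm
    _ ≤ ∑' j : ℕ, ∑' i : Fin d, volume (T (c + j * d + (i : ℕ))) := by
        refine ENNReal.tsum_le_tsum fun j => ?_
        rw [tsum_fintype]
        calc (d:ENNReal) * volume (T (c + j * d + (d - 1 : ℕ)))
            = ∑ i : Fin d, volume (T (c + j * d + (d - 1 : ℕ))) := by simp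
          _ ≤ _ := by
            refine Finset.sum_le_sum fun i _ => ?_
            have hjd : (0:ℤ) ≤ (j:ℤ) * d := by positivity
            have hi := i.2
            have := hanti (c + j * d + (i:ℕ)) (by omega) (d - 1 - i)
            rwa [show c + (j:ℤ) * d + ((i:ℕ):ℤ) + ((d - 1 - (i:ℕ) : ℕ) : ℤ)
              = c + j * d + ((d - 1 : ℕ) : ℤ) by omega] at this
    _ = ∑' x : ℕ × Fin d, volume (T (c + x.1 * d + (x.2 : ℕ))) := by
        exact (ENNReal.tsum_prod (f := fun (j : ℕ) (i : Fin d) => volume (T (c + j * d + (i : ℕ))))).symm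
    _ ≤ volume (⋃ x : ℕ × Fin d, T (c + x.1 * d + (x.2 : ℕ))) :=
        tsum_meas_le_meas_iUnion_of_disjoint _ (fun _ => hmeas _) hpair
    _ ≤ volume (Set.Ico α β) := measure_mono (Set.iUnion_subset fun x y hy => hy.1)
    _ = _ := Real.volume_Ico

lemma convex_diff (k l : ℕ) (hkl : l < k) :
    ConvexOn ℝ (Set.Ici 1) (fun y : ℝ => y ^ k - y ^ l) := by
  have h1 : ConvexOn ℝ (Set.Ici 1) (fun y : ℝ => y ^ l) :=
    (convexOn_pow l).subset (Set.Ici_subset_Ici.2 zero_le_one) (convex_Ici 1)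
  have h2 : ConvexOn ℝ (Set.Ici 1) (fun y : ℝ => y ^ (k - l) - 1) := by
    have h2' : ConvexOn ℝ (Set.Ici 1) (fun y : ℝ => y ^ (k - l)) :=
      (convexOn_pow (k - l)).subset (Set.Ici_subset_Ici.2 zero_le_one) (convex_Ici 1)
    exact h2'.add_const (-1)
  have h3 := h1.mul h2 (fun x hx => pow_nonneg (zero_le_one.trans hx) _)
    (fun x hx => by have := one_le_pow₀ (n := k - l) (show (1:ℝ) ≤ x from hx); linarith) ?_
  · refine h3.congr ?_
    intro y hy
    simp only [Pi.mul_apply]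
    rw [mul_sub, ← pow_add, mul_one]
    congr 2
    omega
  · refine MonotoneOn.monovaryOn (fun x hx y hy h => ?_) (fun x hx y hy h => ?_)
    · exact pow_le_pow_left₀ (zero_le_one.trans hx) h _
    · exact sub_le_sub_right (pow_le_pow_left₀ (zero_le_one.trans hx) h _) _

lemma mono_diff (k l : ℕ) (hkl : l < k) :
    StrictMonoOn (fun y : ℝ => y ^ k - y ^ l) (Set.Ici 1) := by
  intro x hx y hy h
  have hx1 : (1:ℝ) ≤ x := hx
  have hy1 : (1:ℝ) < y := lt_of_le_of_lt hx1 h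
  have e : ∀ z : ℝ, z ^ k - z ^ l = z ^ l * (z ^ (k - l) - 1) := by
    intro z; rw [mul_sub, ← pow_add, mul_one]; congr 2; omega
  simp only [e]
  have h1 : x ^ l ≤ y ^ l := pow_le_pow_left₀ (by linarith) h.le _
  have h2 : x ^ (k-l) < y ^ (k-l) := pow_lt_pow_left₀ h (by linarith) (by omega)
  have h3 : 1 ≤ x ^ (k-l) := one_le_pow₀ hx1
  have h4 : 0 < y ^ l := by positivity
  have h5 : x ^ l * (x ^ (k-l) - 1) ≤ y ^ l * (x ^ (k-l) - 1) :=
    mul_le_mul_of_nonneg_right h1 (by linarith)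
  have h6 : y ^ l * (x ^ (k-l) - 1) < y ^ l * (y ^ (k-l) - 1) :=
    mul_lt_mul_of_pos_left (by linarith) h4
  linarith

/-- collision set -/
def coll (d k l : ℕ) : Set ℝ := {y : ℝ | ⌊y ^ k⌋ ≡ ⌊y ^ l⌋ [ZMOD d]}

lemma measurableSet_coll (d k l : ℕ) : MeasurableSet (coll d k l) := by
  have h : Measurable (fun y : ℝ => ((⌊y ^ k⌋ : ℤ), (⌊y ^ l⌋ : ℤ))) :=
    (Int.measurable_floor.comp (measurable_id.pow_const k)).prodMk
      (Int.measurable_floor.comp (measurable_id.pow_const l))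
  exact h (MeasurableSet.of_discrete (s := {p : ℤ × ℤ | p.1 ≡ p.2 [ZMOD d]}))

lemma coll_large (A B : ℝ) (hA : 1 < A) (L : ℕ) (hL : 1 ≤ A ^ L * (A - 1)) (k l d : ℕ)
    (hl : L ≤ l) (hkl : l < k) (hd : 1 ≤ d) :
    volume (Set.Ico A B ∩ coll d k l) ≤ 2 * (ENNReal.ofReal (B - 1) / d) := by
  have hcont : Continuous (fun y : ℝ => y ^ k - y ^ l) := by fun_prop
  have h1 := spacing _ (convex_diff k l hkl) (mono_diff k l hkl) hcont 1 B le_rfl 1 (by simp) d hd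
  have h2 := spacing _ (convex_diff k l hkl) (mono_diff k l hkl) hcont 1 B le_rfl 0 (by simp) d hd
  have hd0 : (d : ENNReal) ≠ 0 := by simp; omega
  have hdt : (d : ENNReal) ≠ ⊤ := by simp
  rw [mul_comm, ← ENNReal.le_div_iff_mul_le (Or.inl hd0) (Or.inl hdt)] at h1 h2
  rw [two_mul]
  refine le_trans ?_ (add_le_add h1 h2)
  refine le_trans (measure_mono ?_) (measure_union_le _ _)
  rintro y ⟨hy, hyc⟩
  have hyc : ⌊y ^ k⌋ ≡ ⌊y ^ l⌋ [ZMOD d] := hyc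
  have hy1 : 1 < y := hA.trans_le hy.1
  have hge : 1 ≤ y ^ k - y ^ l := by
    have e : y ^ k - y ^ l = y ^ l * (y ^ (k - l) - 1) := by
      rw [mul_sub, ← pow_add, mul_one]; congr 2; omega
    rw [e]
    refine hL.trans (mul_le_mul ?_ ?_ (by linarith) (by positivity))
    · exact (pow_le_pow_left₀ (by linarith) hy.1 L).trans (pow_le_pow_right₀ hy1.le hl)
    · have : y ≤ y ^ (k - l) := le_self_pow₀ hy1.le (by omega)
      linarith [hy.1]
  have hfl : 1 ≤ ⌊y ^ k - y ^ l⌋ := Int.le_floor.2 (by simpa using hge)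
  obtain ⟨t, ht⟩ := hyc.symm.dvd
  have hcases : ⌊y ^ k - y ^ l⌋ = ⌊y ^ k⌋ - ⌊y ^ l⌋ ∨ ⌊y ^ k - y ^ l⌋ = ⌊y ^ k⌋ - ⌊y ^ l⌋ - 1 := by
    have a1 := Int.floor_le (y ^ k)
    have a2 := Int.lt_floor_add_one (y ^ k)
    have a3 := Int.floor_le (y ^ l)
    have a4 := Int.lt_floor_add_one (y ^ l)
    have a5 : ⌊y ^ k - y ^ l⌋ < ⌊y ^ k⌋ - ⌊y ^ l⌋ + 1 := Int.floor_lt.2 (by push_cast; linarith)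
    have a6 : ⌊y ^ k⌋ - ⌊y ^ l⌋ - 1 ≤ ⌊y ^ k - y ^ l⌋ := Int.le_floor.2 (by push_cast; linarith)
    omega
  rcases hcases with h | h
  · left
    refine ⟨⟨hy1.le, hy.2⟩, hfl, ?_⟩
    rw [h, ht]
    exact (Int.modEq_iff_dvd.2 ⟨-t, by ring⟩)
  · right
    refine ⟨⟨hy1.le, hy.2⟩, by omega, ?_⟩
    rw [h, ht]
    exact (Int.modEq_iff_dvd.2 ⟨-t, by ring⟩)

lemma pow_sub_ge (k : ℕ) (x y : ℝ) (hx : 0 ≤ x) (hxy : x ≤ y) :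
    k * x ^ (k - 1) * (y - x) ≤ y ^ k - x ^ k := by
  have := (Commute.all y x).geom_sum₂_mul (n := k)
  rw [← this]
  refine mul_le_mul_of_nonneg_right ?_ (by linarith)
  calc (k:ℝ) * x ^ (k-1) = ∑ i ∈ Finset.range k, x ^ (k-1) := by simp
    _ ≤ _ := Finset.sum_le_sum fun i hi => by
      have := Finset.mem_range.1 hi
      rw [show x ^ (k-1) = x ^ i * x ^ (k-1-i) by rw [← pow_add]; congr 1; omega]
      exact mul_le_mul_of_nonneg_right (pow_le_pow_left₀ hx hxy i) (by positivity)

lemma pow_sub_le' (k : ℕ) (x y : ℝ) (hx : 0 ≤ x) (hxy : x ≤ y) :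
    y ^ k - x ^ k ≤ k * y ^ (k - 1) * (y - x) := by
  have := (Commute.all y x).geom_sum₂_mul (n := k)
  rw [← this]
  refine mul_le_mul_of_nonneg_right ?_ (by linarith)
  calc _ ≤ ∑ i ∈ Finset.range k, y ^ (k-1) := Finset.sum_le_sum fun i hi => by
        have := Finset.mem_range.1 hi
        rw [show y ^ (k-1) = y ^ i * y ^ (k-1-i) by rw [← pow_add]; congr 1; omega]
        exact mul_le_mul_of_nonneg_left (pow_le_pow_left₀ hx hxy _) (pow_nonneg (hx.trans hxy) _)
    _ = (k:ℝ) * y ^ (k-1) := by simp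

lemma piece_small (k : ℕ) (hk : 1 ≤ k) (α β : ℝ) (hα : 1 ≤ α) (m : ℤ) :
    volume {y : ℝ | y ∈ Set.Ico α β ∧ ⌊y ^ k⌋ = m} ≤ ENNReal.ofReal (1 / (k * α ^ (k - 1))) := by
  refine (Real.volume_le_diam _).trans ?_
  have hpos : 0 < (k:ℝ) * α ^ (k-1) := by positivity
  have key : ∀ x ∈ {y : ℝ | y ∈ Set.Ico α β ∧ ⌊y ^ k⌋ = m}, ∀ y ∈ {y : ℝ | y ∈ Set.Ico α β ∧ ⌊y ^ k⌋ = m},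
      x ≤ y → y - x ≤ 1 / (k * α ^ (k - 1)) := by
    rintro x ⟨hx, hxm⟩ y ⟨hy, hym⟩ hxy
    have h1 := Int.floor_eq_iff.1 hxm
    have h2 := Int.floor_eq_iff.1 hym
    have h3 := pow_sub_ge k x y (by linarith [hx.1]) hxy
    rw [le_div_iff₀ hpos]
    have h4 : (k:ℝ) * α ^ (k-1) ≤ k * x ^ (k-1) :=
      mul_le_mul_of_nonneg_left (pow_le_pow_left₀ (by linarith) hx.1 _) (by positivity)
    have h5 := mul_le_mul_of_nonneg_right h4 (sub_nonneg.2 hxy)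
    linarith
  refine Metric.ediam_le fun x hx y hy => ?_
  rw [edist_dist, Real.dist_eq]
  apply ENNReal.ofReal_le_ofReal
  rcases le_total x y with h | h
  · rw [abs_sub_comm, abs_of_nonneg (sub_nonneg.2 h)]; exact key x hx y hy h
  · rw [abs_of_nonneg (sub_nonneg.2 h)]; exact key y hy x hx h

lemma cell_bound (k d : ℕ) (hk : 1 ≤ k) (hd : 1 ≤ d) (α β : ℝ) (hα : 1 ≤ α) (b : ℤ) :
    volume {y : ℝ | y ∈ Set.Ico α β ∧ ⌊y ^ k⌋ ≡ b [ZMOD d]} ≤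
      ENNReal.ofReal (β - α) / d + 2 * ENNReal.ofReal (1 / (k * α ^ (k - 1))) := by
  have hc : ConvexOn ℝ (Set.Ici 1) (fun y : ℝ => y ^ k) :=
    (convexOn_pow k).subset (Set.Ici_subset_Ici.2 zero_le_one) (convex_Ici 1)
  have hm : StrictMonoOn (fun y : ℝ => y ^ k) (Set.Ici 1) := by
    intro x hx y hy h
    exact pow_lt_pow_left₀ h (zero_le_one.trans hx) (by omega)
  have hcont : Continuous (fun y : ℝ => y ^ k) := by fun_prop
  set m0 : ℤ := ⌈α ^ k⌉ with hm0
  set e : ℤ := m0 + (b - m0) % d with he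
  have hdpos : (0:ℤ) < d := by exact_mod_cast hd
  have he0 : m0 ≤ e := by have := Int.emod_nonneg (b - m0) hdpos.ne'; omega
  have he1 : e < m0 + d := by have := Int.emod_lt_of_pos (b - m0) hdpos; omega
  have heb : e ≡ b [ZMOD d] := by
    have : (b - m0) % d ≡ b - m0 [ZMOD d] := Int.mod_modEq _ _
    have := this.add_left m0
    simpa [he] using this
  have h1 := spacing _ hc hm hcont α β hα (e + 1)
    ((Int.le_ceil _).trans (by exact_mod_cast (by omega : m0 ≤ e + 1))) d hd
  have hd0 : (d : ENNReal) ≠ 0 := by simp; omega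
  have hdt : (d : ENNReal) ≠ ⊤ := by simp
  rw [mul_comm, ← ENNReal.le_div_iff_mul_le (Or.inl hd0) (Or.inl hdt)] at h1
  have h2 := piece_small k hk α β hα e
  have h3 := piece_small k hk α β hα (m0 - 1)
  rw [two_mul]
  refine le_trans ?_ (add_le_add h1 (add_le_add h2 h3))
  refine le_trans (measure_mono ?_) ((measure_union_le _ _).trans (add_le_add_right (measure_union_le _ _) _))
  rintro y ⟨hy, hyb⟩
  have hlow : m0 - 1 ≤ ⌊y ^ k⌋ := by
    refine Int.le_floor.2 ?_
    have := Int.ceil_lt_add_one (α ^ k)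
    have h4 : α ^ k ≤ y ^ k := pow_le_pow_left₀ (by linarith) hy.1 k
    push_cast; rw [← hm0] at this; linarith
  by_cases hbig : e + 1 ≤ ⌊y ^ k⌋
  · left
    refine ⟨hy, hbig, ?_⟩
    simpa using hyb.trans heb.symm
  · right
    by_cases hz : ⌊y ^ k⌋ = m0 - 1
    · right; exact ⟨hy, hz⟩
    · left; refine ⟨hy, ?_⟩
      obtain ⟨t, ht⟩ := (hyb.trans heb.symm).dvd
      have : t = 0 := by
        have a1 : (d:ℤ) * t < d * 1 := by omega
        have a2 : (d:ℤ) * (-1) < d * t := by omega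
        have := lt_of_mul_lt_mul_left a1 hdpos.le
        have := lt_of_mul_lt_mul_left a2 hdpos.le
        omega
      rw [this] at ht; omega

lemma coll_small (A B : ℝ) (hA : 1 < A) (hAB : A ≤ B) (k l d : ℕ) (hl : 1 ≤ l) (hkl : l < k)
    (hd : 1 ≤ d) :
    volume (Set.Ico A B ∩ coll d k l) ≤
      ENNReal.ofReal (B - A) / d + ENNReal.ofReal (4 * (B + 1) * (A⁻¹) ^ (k - l)) := by
  obtain ⟨r, hr⟩ : ∃ r : ℕ → ℝ, r = fun b : ℕ => (b : ℝ) ^ ((1:ℝ) / l) := ⟨_, rfl⟩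
  have hl0 : l ≠ 0 := by omega
  have r0 : ∀ b, 0 ≤ r b := fun b => by rw [hr]; positivity
  have rp : ∀ b, r b ^ l = b := fun b => by
    rw [hr]; simp only [one_div]; exact Real.rpow_inv_natCast_pow (by positivity) hl0
  have rle : ∀ b (y : ℝ), 0 ≤ y → (r b ≤ y ↔ (b:ℝ) ≤ y ^ l) := fun b y hy => by
    rw [← rp b]; exact (pow_le_pow_iff_left₀ (r0 b) hy hl0).symm
  have rmono : Monotone r := fun a b hab => by
    rw [rle a _ (r0 b), rp]; exact_mod_cast hab
  have r1 : r 1 = 1 := by rw [hr]; simp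
  set n := ⌊B ^ l⌋₊ with hn
  set C : ℕ → Set ℝ := fun b => Set.Ico (max A (r b)) (min B (r (b + 1))) with hC
  have hsub : Set.Ico A B ∩ coll d k l ⊆
      ⋃ b ∈ Finset.Icc 1 n, {y : ℝ | y ∈ C b ∧ ⌊y ^ k⌋ ≡ (b : ℤ) [ZMOD d]} := by
    rintro y ⟨hy, hyc⟩
    have hyc : ⌊y ^ k⌋ ≡ ⌊y ^ l⌋ [ZMOD d] := hyc
    have hy1 : 1 < y := hA.trans_le hy.1
    have hyl : 1 ≤ y ^ l := one_le_pow₀ hy1.le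
    have hfl : ((⌊y ^ l⌋₊ : ℕ) : ℤ) = ⌊y ^ l⌋ := Int.natCast_floor_eq_floor (by linarith)
    simp only [Set.mem_iUnion]
    refine ⟨⌊y ^ l⌋₊, Finset.mem_Icc.2 ⟨Nat.le_floor (by simpa using hyl), ?_⟩, ⟨?_, ?_⟩, ?_⟩
    · exact Nat.floor_le_floor (pow_le_pow_left₀ (by linarith) hy.2.le l)
    · exact max_le hy.1 ((rle _ _ (by linarith)).2 (Nat.floor_le (by linarith)))
    · refine lt_min hy.2 ?_
      by_contra h
      have := (rle _ _ (by linarith)).1 (not_lt.1 h)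
      have h2 := Nat.lt_floor_add_one (y ^ l)
      push_cast at this
      linarith
    · rw [hfl]; exact hyc
  have hA0 : 0 < A := by linarith
  have hpiece : ∀ b, 1 ≤ b → 1 / (k * (max A (r b)) ^ (k - 1)) ≤
      2 * (A⁻¹) ^ (k - l) * (r (b + 1) - r b) := by
    intro b hb
    set α := max A (r b) with hα
    have hαA : A ≤ α := le_max_left _ _
    have hαr : r b ≤ α := le_max_right _ _
    have hα0 : 0 < α := by linarith
    have hrb : 1 ≤ r b := by rw [← r1]; exact rmono hb
    have h1 := pow_sub_le' l (r b) (r (b+1)) (r0 b) (rmono (Nat.le_succ b))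
    rw [rp, rp] at h1
    push_cast at h1
    have hΔ : 0 ≤ r (b+1) - r b := sub_nonneg.2 (rmono (Nat.le_succ b))
    have h2 : r (b+1) ^ (l-1) ≤ 2 * r b ^ (l-1) := by
      have e1 : r (b+1) ^ (l-1) * r (b+1) = b + 1 := by
        rw [← pow_succ, Nat.sub_add_cancel hl, rp]; push_cast; rfl
      have e2 : r b ^ (l-1) * r b = b := by
        rw [← pow_succ, Nat.sub_add_cancel hl, rp]
      have e3 : r (b+1) ^ (l-1) * r b ≤ r (b+1) ^ (l-1) * r (b+1) :=
        mul_le_mul_of_nonneg_left (rmono (Nat.le_succ b)) (pow_nonneg (r0 _) _)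
      have hb' : (1:ℝ) ≤ b := by exact_mod_cast hb
      refine le_of_mul_le_mul_right ?_ (by linarith : 0 < r b)
      nlinarith
    have h3 : r b ^ (l-1) ≤ α ^ (l-1) := pow_le_pow_left₀ (r0 b) hαr _
    have h4 : 1 ≤ k * (2 * α ^ (l-1)) * (r (b+1) - r b) := by
      have : (l:ℝ) * r (b+1) ^ (l-1) * (r (b+1) - r b) ≤ k * (2 * α ^ (l-1)) * (r (b+1) - r b) := by
        refine mul_le_mul_of_nonneg_right ?_ hΔ
        refine mul_le_mul (by exact_mod_cast hkl.le) (by linarith) (pow_nonneg (r0 _) _) (by positivity)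
      linarith
    have hk0 : (0:ℝ) < k := by exact_mod_cast (by omega : 0 < k)
    rw [div_le_iff₀ (by positivity)]
    have e : α ^ (k-1) = α ^ (l-1) * α ^ (k-l) := by rw [← pow_add]; congr 1; omega
    have h5 : 1 ≤ (A⁻¹) ^ (k-l) * α ^ (k-l) := by
      rw [← mul_pow]
      apply one_le_pow₀
      rw [inv_mul_eq_div, le_div_iff₀ hA0]; linarith
    calc (1:ℝ) ≤ (k * (2 * α ^ (l-1)) * (r (b+1) - r b)) * 1 := by linarith
      _ ≤ (k * (2 * α ^ (l-1)) * (r (b+1) - r b)) * ((A⁻¹) ^ (k-l) * α ^ (k-l)) :=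
        mul_le_mul_of_nonneg_left h5 (by linarith)
      _ = _ := by rw [e]; ring
  have hdisj : ∀ a b : ℕ, a < b → Disjoint (C a) (C b) := by
    intro a b hab
    rw [Set.disjoint_left]
    rintro y hy hy'
    have h1 := hy.2.trans_le (min_le_right _ _)
    have h2 := (le_max_right _ _).trans hy'.1
    have h3 := rmono (show a + 1 ≤ b from hab)
    linarith
  have hsum1 : ∑ b ∈ Finset.Icc 1 n, ENNReal.ofReal (min B (r (b+1)) - max A (r b)) ≤
      ENNReal.ofReal (B - A) := by
    rw [← Real.volume_Ico]
    simp only [← Real.volume_Ico]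
    rw [← measure_biUnion_finset]
    · refine measure_mono (Set.iUnion₂_subset fun b _ y hy => ⟨(le_max_left _ _).trans hy.1, hy.2.trans_le (min_le_left _ _)⟩)
    · intro a _ b _ hab
      rcases lt_or_gt_of_ne hab with h | h
      · exact hdisj a b h
      · exact (hdisj b a h).symm
    · intro b _; exact measurableSet_Ico
  have hsum2 : ∑ b ∈ Finset.Icc 1 n, (r (b+1) - r b) ≤ B + 1 := by
    have : Finset.Icc 1 n = Finset.Ico 1 (n+1) := by ext; simp
    rw [this, Finset.sum_Ico_sub r (by omega), r1]
    have : r (n+1) ≤ B + 1 := by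
      rw [rle _ _ (by linarith)]
      push_cast
      have h1 : (n:ℝ) ≤ B ^ l := Nat.floor_le (pow_nonneg (by linarith) _)
      have h2 : B ^ l + 1 ^ l ≤ (B + 1) ^ l := pow_add_pow_le (by linarith) zero_le_one hl0
      rw [one_pow] at h2
      linarith
    linarith
  calc volume (Set.Ico A B ∩ coll d k l)
      ≤ ∑ b ∈ Finset.Icc 1 n, volume {y : ℝ | y ∈ C b ∧ ⌊y ^ k⌋ ≡ (b : ℤ) [ZMOD d]} :=
        (measure_mono hsub).trans (measure_biUnion_finset_le _ _)
    _ ≤ ∑ b ∈ Finset.Icc 1 n, (ENNReal.ofReal (min B (r (b+1)) - max A (r b)) / d +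
          ENNReal.ofReal (2 * (2 * (A⁻¹) ^ (k - l) * (r (b + 1) - r b)))) := by
        refine Finset.sum_le_sum fun b hb => ?_
        refine (cell_bound k d (by omega) hd _ _ (hA.le.trans (le_max_left _ _)) b).trans ?_
        refine add_le_add_right ?_ _
        rw [ENNReal.ofReal_mul (p := 2) (by norm_num), ENNReal.ofReal_ofNat]
        gcongr
        exact hpiece b (Finset.mem_Icc.1 hb).1
    _ = (∑ b ∈ Finset.Icc 1 n, ENNReal.ofReal (min B (r (b+1)) - max A (r b))) / d +
          ENNReal.ofReal (∑ b ∈ Finset.Icc 1 n, (2 * (2 * (A⁻¹) ^ (k - l) * (r (b + 1) - r b)))) := by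
        rw [Finset.sum_add_distrib, ENNReal.ofReal_sum_of_nonneg]
        · simp only [div_eq_mul_inv, Finset.sum_mul]
        · intro b _
          have : 0 ≤ r (b+1) - r b := sub_nonneg.2 (rmono (Nat.le_succ b))
          positivity
    _ ≤ _ := by
        gcongr
        rw [← Finset.mul_sum, ← Finset.mul_sum]
        have : 0 ≤ (A⁻¹) ^ (k-l) := by positivity
        nlinarith

noncomputable def nn (K d a : ℕ) (y : ℝ) : ℕ :=
  ((Finset.Icc 1 K).filter fun k => ⌊y ^ k⌋ ≡ (a : ℤ) [ZMOD (d : ℤ)]).card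

noncomputable def VV (K d : ℕ) (y : ℝ) : ℝ :=
  ∑ k ∈ Finset.Icc 1 K, ∑ l ∈ Finset.Icc 1 K, ((coll d k l).indicator (fun _ => (1:ℝ)) y - 1 / d)

noncomputable def PP (L K d : ℕ) (y : ℝ) : ℝ :=
  ∑ k ∈ Finset.Icc 1 K, ∑ l ∈ Finset.Ioo L k, (coll d k l).indicator (fun _ => (1:ℝ)) y

lemma fiber_sq {C : Type*} [Fintype C] [DecidableEq C] (hC : 0 < Fintype.card C) (S : Finset ℕ)
    (r : ℕ → C) (c : C) :
    (((S.filter fun k => r k = c).card : ℝ) - S.card / Fintype.card C) ^ 2 ≤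
      ∑ k ∈ S, ∑ l ∈ S, ((if r k = r l then (1:ℝ) else 0) - 1 / Fintype.card C) := by
  set D : ℝ := (Fintype.card C : ℝ) with hD
  have hD0 : 0 < D := by rw [hD]; exact_mod_cast hC
  set n : C → ℝ := fun c => ∑ k ∈ S, if r k = c then (1:ℝ) else 0 with hn
  have hnc : ((S.filter fun k => r k = c).card : ℝ) = n c := by
    simp [hn, Finset.sum_ite]
  have h1 : ∑ c, n c = S.card := by
    simp only [hn]; rw [Finset.sum_comm]; simp
  have h2 : ∑ c, n c ^ 2 = ∑ k ∈ S, ∑ l ∈ S, (if r k = r l then (1:ℝ) else 0) := by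
    simp only [hn, sq, Finset.sum_mul_sum]
    rw [Finset.sum_comm]
    refine Finset.sum_congr rfl fun k _ => ?_
    rw [Finset.sum_comm]
    refine Finset.sum_congr rfl fun l _ => ?_
    simp [eq_comm]
  have h3 : ∑ c, (n c - S.card / D) ^ 2 =
      ∑ k ∈ S, ∑ l ∈ S, ((if r k = r l then (1:ℝ) else 0) - 1 / D) := by
    have : ∀ c, (n c - S.card / D) ^ 2 = n c ^ 2 - 2 * (S.card / D) * n c + (S.card / D) ^ 2 := by
      intro c; ring
    simp only [this, Finset.sum_add_distrib, Finset.sum_sub_distrib, ← Finset.mul_sum, h1, h2]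
    simp only [Finset.sum_const, Finset.card_univ, nsmul_eq_mul, ← hD]
    field_simp
    ring
  rw [← h3, hnc]
  exact Finset.single_le_sum (f := fun c => (n c - S.card / D) ^ 2) (fun _ _ => sq_nonneg _) (Finset.mem_univ c)

lemma nn_sq (K d a : ℕ) (hd : 1 ≤ d) (y : ℝ) : ((nn K d a y : ℝ) - K / d) ^ 2 ≤ VV K d y := by
  classical
  have : NeZero d := ⟨by omega⟩
  have := fiber_sq (C := ZMod d) (by rw [ZMod.card]; omega) (Finset.Icc 1 K)
    (fun k => ((⌊y ^ k⌋ : ℤ) : ZMod d)) ((a : ℤ) : ZMod d)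
  simp only [ZMod.intCast_eq_intCast_iff, ZMod.card, Nat.card_Icc, Nat.add_sub_cancel] at this
  unfold nn VV
  convert this using 2
  refine Finset.sum_congr rfl fun l _ => ?_
  simp only [Set.indicator_apply]
  congr 1
  exact if_congr Iff.rfl rfl rfl

lemma PP_nonneg (L K d : ℕ) (y : ℝ) : 0 ≤ PP L K d y :=
  Finset.sum_nonneg fun _ _ => Finset.sum_nonneg fun _ _ => Set.indicator_nonneg (by simp) _

lemma nn_le (L K d a : ℕ) (y : ℝ) : (nn K d a y : ℝ) ≤ L + 1 + PP L K d y := by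
  classical
  set T := (Finset.Icc 1 K).filter fun k => ⌊y ^ k⌋ ≡ (a : ℤ) [ZMOD (d : ℤ)] with hT
  have h1 : (T.card : ℝ) ≤ L + (T.filter fun k => L < k).card := by
    have := Finset.card_filter_add_card_filter_not (s := T) (fun k => L < k)
    have h2 : (T.filter fun k => ¬ L < k).card ≤ (Finset.Icc 1 L).card := by
      apply Finset.card_le_card
      intro k hk
      simp only [hT, Finset.mem_filter, Finset.mem_Icc] at hk ⊢
      omega
    rw [Nat.card_Icc] at h2
    have : T.card ≤ L + (T.filter fun k => L < k).card := by omega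
    exact_mod_cast this
  have h2 : ((T.filter fun k => L < k).card : ℝ) ≤ 1 + PP L K d y := by
    rcases (T.filter fun k => L < k).eq_empty_or_nonempty with h | h
    · rw [h]; have := PP_nonneg L K d y; simp; linarith
    · set l0 := (T.filter fun k => L < k).min' h with hl0
      have hl0m := Finset.min'_mem _ h
      rw [← hl0] at hl0m
      have e := Finset.card_erase_add_one hl0m
      have : (((T.filter fun k => L < k).erase l0).card : ℝ) ≤ PP L K d y := by
        rw [Finset.card_eq_sum_ones]
        push_cast
        unfold PP
        refine le_trans (Finset.sum_le_sum fun k hk => ?_) (Finset.sum_le_sum_of_subset_of_nonneg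
          (s := (T.filter fun k => L < k).erase l0) ?_ ?_)
        · have hk1 := Finset.mem_erase.1 hk
          have hlt : l0 < k := lt_of_le_of_ne (Finset.min'_le _ _ hk1.2) (Ne.symm hk1.1)
          have hmem : l0 ∈ Finset.Ioo L k := Finset.mem_Ioo.2 ⟨(Finset.mem_filter.1 hl0m).2, hlt⟩
          have hcoll : y ∈ coll d k l0 := by
            have a1 := (Finset.mem_filter.1 (Finset.mem_filter.1 hk1.2).1).2
            have a2 := (Finset.mem_filter.1 (Finset.mem_filter.1 hl0m).1).2
            exact a1.trans a2.symm
          have := Finset.single_le_sum (f := fun l => (coll d k l).indicator (fun _ => (1:ℝ)) y)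
            (fun _ _ => Set.indicator_nonneg (by simp) _) hmem
          simpa [Set.indicator_of_mem hcoll] using this
        · intro k hk
          exact (Finset.mem_filter.1 (Finset.mem_filter.1 (Finset.mem_erase.1 hk).2).1).1
        · intro k _ _
          exact Finset.sum_nonneg fun _ _ => Set.indicator_nonneg (by simp) _
      have e' : ((T.filter fun k => L < k).card : ℝ) = ((T.filter fun k => L < k).erase l0).card + 1 := by
        exact_mod_cast e.symm
      linarith
  show (T.card : ℝ) ≤ _
  linarith

lemma geom_bound (q : ℝ) (hq0 : 0 ≤ q) (hq1 : q < 1) (n : ℕ) :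
    ∑ i ∈ Finset.range n, q ^ i ≤ (1 - q)⁻¹ := by
  rw [← tsum_geometric_of_lt_one hq0 hq1]
  exact (summable_geometric_of_lt_one hq0 hq1).sum_le_tsum _ (fun _ _ => by positivity)

lemma dist_sum (q : ℝ) (hq0 : 0 ≤ q) (hq1 : q < 1) (K k : ℕ) :
    ∑ l ∈ Finset.Icc 1 K, q ^ ((k - l) + (l - k)) ≤ 2 * (1 - q)⁻¹ := by
  have h1 : ∑ l ∈ Finset.range (k+1), q ^ ((k - l) + (l - k)) ≤ (1 - q)⁻¹ := by
    rw [← Finset.sum_range_reflect]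
    refine le_trans (Finset.sum_le_sum fun i hi => ?_) (geom_bound q hq0 hq1 (k+1))
    have := Finset.mem_range.1 hi
    rw [show k - (k + 1 - 1 - i) + (k + 1 - 1 - i - k) = i by omega]
  have h2 : ∑ l ∈ Finset.Ico k (K+1), q ^ ((k - l) + (l - k)) ≤ (1 - q)⁻¹ := by
    rw [Finset.sum_Ico_eq_sum_range]
    refine le_trans (Finset.sum_le_sum fun i hi => ?_) (geom_bound q hq0 hq1 (K+1-k))
    rw [show k - (k + i) + (k + i - k) = i by omega]
  have h3 : ∑ l ∈ Finset.Icc 1 K, q ^ ((k - l) + (l - k)) ≤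
      ∑ l ∈ Finset.range (k+1) ∪ Finset.Ico k (K+1), q ^ ((k - l) + (l - k)) := by
    refine Finset.sum_le_sum_of_subset_of_nonneg ?_ (fun _ _ _ => by positivity)
    intro l hl
    simp only [Finset.mem_Icc, Finset.mem_union, Finset.mem_range, Finset.mem_Ico] at hl ⊢
    omega
  have h4 := Finset.sum_union_inter (s₁ := Finset.range (k+1)) (s₂ := Finset.Ico k (K+1))
    (f := fun l => q ^ ((k - l) + (l - k)))
  have h5 : 0 ≤ ∑ l ∈ Finset.range (k+1) ∩ Finset.Ico k (K+1), q ^ ((k - l) + (l - k)) :=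
    Finset.sum_nonneg fun _ _ => by positivity
  linarith

lemma coll_symm (d k l : ℕ) : coll d k l = coll d l k := by
  ext y; exact ⟨fun h => Int.ModEq.symm h, fun h => Int.ModEq.symm h⟩

lemma coll_real (A B : ℝ) (hA : 1 < A) (hAB : A ≤ B) (k l d : ℕ) (hl : 1 ≤ l) (hk : 1 ≤ k)
    (hd : 1 ≤ d) :
    (volume.restrict (Set.Ico A B)).real (coll d k l) - (B - A) / d ≤
      4 * (B + 1) * (A⁻¹) ^ ((k - l) + (l - k)) := by
  rw [measureReal_restrict_apply (measurableSet_coll _ _ _), Set.inter_comm]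
  have main : ∀ k l : ℕ, 1 ≤ l → l < k → volume.real (Set.Ico A B ∩ coll d k l) ≤
      (B - A) / d + 4 * (B + 1) * (A⁻¹) ^ (k - l) := by
    intro k l hl hkl
    have h := coll_small A B hA hAB k l d hl hkl hd
    have hA0 : 0 < A := by linarith
    have h1 : ENNReal.ofReal (B - A) / d = ENNReal.ofReal ((B - A) / d) := by
      rw [ENNReal.ofReal_div_of_pos (by exact_mod_cast hd), ENNReal.ofReal_natCast]
    rw [h1, ← ENNReal.ofReal_add (div_nonneg (by linarith) (by positivity))
      (mul_nonneg (by linarith) (by positivity))] at h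
    exact ENNReal.toReal_le_of_le_ofReal (add_nonneg (div_nonneg (by linarith) (by positivity))
      (mul_nonneg (by linarith) (by positivity))) h
  rcases lt_trichotomy l k with h | h | h
  · have := main k l hl h
    rw [show l - k = 0 by omega, add_zero]; linarith
  · subst h
    have h1 : volume.real (Set.Ico A B ∩ coll d l l) ≤ volume.real (Set.Ico A B) :=
      measureReal_mono Set.inter_subset_left (by simp)
    rw [Real.volume_real_Ico_of_le hAB] at h1
    have : 0 ≤ (B - A) / d := div_nonneg (by linarith) (by positivity)
    simp; linarith
  · have := main l k hk h
    rw [coll_symm, show k - l = 0 by omega, zero_add]; linarith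

lemma int_ind (A B : ℝ) (d k l : ℕ) :
    Integrable ((coll d k l).indicator (fun _ => (1:ℝ))) (volume.restrict (Set.Ico A B)) :=
  (integrable_const 1).indicator (measurableSet_coll d k l)

lemma int_sub (A B : ℝ) (d k l : ℕ) :
    Integrable (fun y => (coll d k l).indicator (fun _ => (1:ℝ)) y - 1 / (d:ℝ))
      (volume.restrict (Set.Ico A B)) :=
  (int_ind A B d k l).sub (integrable_const _)

lemma int_VV (A B : ℝ) (K d : ℕ) : Integrable (VV K d) (volume.restrict (Set.Ico A B)) := by
  unfold VV
  exact integrable_finsetSum _ fun k _ => integrable_finsetSum _ fun l _ =>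
    int_sub A B d k l

lemma int_PP (A B : ℝ) (L K d : ℕ) : Integrable (PP L K d) (volume.restrict (Set.Ico A B)) := by
  unfold PP
  exact integrable_finsetSum _ fun k _ => integrable_finsetSum _ fun l _ => int_ind A B d k l

lemma integral_VV (A B : ℝ) (hA : 1 < A) (hAB : A ≤ B) (K d : ℕ) (hd : 1 ≤ d) :
    ∫ y in Set.Ico A B, VV K d y ≤ (4 * (B + 1) * (2 * (1 - A⁻¹)⁻¹)) * K := by
  unfold VV
  rw [integral_finsetSum _ (fun k _ => integrable_finsetSum _ fun l _ =>
    int_sub A B d k l)]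
  have : ∀ k ∈ Finset.Icc 1 K, ∫ y in Set.Ico A B, ∑ l ∈ Finset.Icc 1 K,
      ((coll d k l).indicator (fun _ => (1:ℝ)) y - 1 / d) ≤ 4 * (B + 1) * (2 * (1 - A⁻¹)⁻¹) := by
    intro k hk
    rw [integral_finsetSum _ (fun l _ => int_sub A B d k l)]
    refine le_trans (Finset.sum_le_sum (g := fun l => 4 * (B+1) * (A⁻¹) ^ ((k - l) + (l - k))) fun l hl => ?_) ?_
    · rw [integral_sub (int_ind A B d k l) (integrable_const _),
        integral_indicator_const _ (measurableSet_coll d k l)]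
      have := coll_real A B hA hAB k l d (Finset.mem_Icc.1 hl).1 (Finset.mem_Icc.1 hk).1 hd
      refine le_trans (le_of_eq ?_) this
      rw [integral_const, measureReal_restrict_apply_univ, Real.volume_real_Ico_of_le hAB]
      simp [div_eq_mul_inv]
    · rw [← Finset.mul_sum]
      exact mul_le_mul_of_nonneg_left (dist_sum _ (by positivity) (inv_lt_one_of_one_lt₀ hA) K k) (by linarith)
  refine (Finset.sum_le_sum this).trans (le_of_eq ?_)
  simp; ring

lemma integral_PP (A B : ℝ) (hA : 1 < A) (hAB : A ≤ B) (L : ℕ) (hL : 1 ≤ A ^ L * (A - 1))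
    (K d : ℕ) (hd : 1 ≤ d) :
    ∫ y in Set.Ico A B, PP L K d y ≤ 2 * (B - 1) * K ^ 2 / d := by
  unfold PP
  rw [integral_finsetSum _ (fun k _ => integrable_finsetSum _ fun l _ => int_ind A B d k l)]
  have hB : 0 ≤ 2 * (B - 1) / d := div_nonneg (by linarith) (by positivity)
  have : ∀ k ∈ Finset.Icc 1 K, ∫ y in Set.Ico A B, ∑ l ∈ Finset.Ioo L k,
      (coll d k l).indicator (fun _ => (1:ℝ)) y ≤ K * (2 * (B - 1) / d) := by
    intro k hk
    rw [integral_finsetSum _ (fun l _ => int_ind A B d k l)]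
    refine le_trans (Finset.sum_le_sum (g := fun l => 2 * (B - 1) / d) fun l hl => ?_) ?_
    · rw [integral_indicator_const _ (measurableSet_coll d k l), smul_eq_mul, mul_one,
        measureReal_restrict_apply (measurableSet_coll _ _ _), Set.inter_comm]
      have hl := Finset.mem_Ioo.1 hl
      have h := coll_large A B hA L hL k l d hl.1.le hl.2 hd
      refine ENNReal.toReal_le_of_le_ofReal hB (h.trans (le_of_eq ?_))
      rw [ENNReal.ofReal_div_of_pos (by exact_mod_cast hd), ENNReal.ofReal_natCast,
        ENNReal.ofReal_mul (by norm_num), ENNReal.ofReal_ofNat, mul_div_assoc]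
    · rw [Finset.sum_const, nsmul_eq_mul]
      refine mul_le_mul_of_nonneg_right ?_ hB
      rw [Nat.card_Ioo]
      have := (Finset.mem_Icc.1 hk).2
      exact_mod_cast (by omega : k - L - 1 ≤ K)
  refine (Finset.sum_le_sum this).trans (le_of_eq ?_)
  simp; ring

lemma VV_nonneg (K d : ℕ) (hd : 1 ≤ d) (y : ℝ) : 0 ≤ VV K d y :=
  (sq_nonneg _).trans (nn_sq K d 1 hd y)

lemma harm_le (n : ℕ) : ∑ d ∈ Finset.Icc 1 n, (1 / (d:ℝ)) ≤ 1 + Real.log n := by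
  have := harmonic_le_one_add_log n
  rw [harmonic_eq_sum_Icc] at this
  push_cast at this
  simpa using this

lemma sq_sum_le (n : ℕ) : ∑ d ∈ Finset.Icc 1 n, (1 / (d:ℝ) ^ 2) ≤ 2 := by
  have := sum_Ioo_inv_sq_le (α := ℝ) 0 (n + 1)
  have e : Finset.Icc 1 n = Finset.Ioo 0 (n+1) := by ext; simp; omega
  rw [e]
  simpa using this

lemma harm_R (j : ℕ) :
    ∑ d ∈ Finset.Icc (1:ℕ) ((16 ^ j) ^ 2), (1 / (d:ℝ)) ≤ 9 * 2 ^ j := by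
  refine (harm_le _).trans ?_
  have e : (((16 ^ j) ^ 2 : ℕ) : ℝ) = ((2:ℝ) ^ j) ^ 8 := by
    push_cast
    rw [show (16:ℝ) = 2 ^ 4 by norm_num, ← pow_mul, ← pow_mul, ← pow_mul]; congr 1; ring
  rw [e, Real.log_pow]
  have h1 := Real.log_le_sub_one_of_pos (show (0:ℝ) < 2 ^ j by positivity)
  have h2 : (0:ℝ) < 2 ^ j := by positivity
  push_cast
  linarith

noncomputable def XX (A : ℝ) (L j : ℕ) (y : ℝ) : ℝ :=
  ∑ d ∈ Finset.Icc (1:ℕ) ((16 ^ j) ^ 2), (1 / ((2 ^ j) ^ 3 * 16 ^ j) * (1 / (d:ℝ))) * VV (16 ^ j) d y +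
  ∑ d ∈ Finset.Ioc ((16 ^ j) ^ 2) ⌊A ^ (16 ^ j)⌋₊, (1 / 16 ^ j * (1 / (d:ℝ))) * PP L (16 ^ j) d y

lemma XX_nonneg (A : ℝ) (L j : ℕ) (y : ℝ) : 0 ≤ XX A L j y := by
  unfold XX
  refine add_nonneg (Finset.sum_nonneg fun d hd => ?_) (Finset.sum_nonneg fun d hd => ?_)
  · have := VV_nonneg (16 ^ j) d (Finset.mem_Icc.1 hd).1 y
    positivity
  · have := PP_nonneg L (16 ^ j) d y
    positivity

lemma int_XX (A B : ℝ) (L j : ℕ) : Integrable (XX A L j) (volume.restrict (Set.Ico A B)) := by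
  unfold XX
  exact (integrable_finsetSum _ fun d _ => (int_VV A B _ d).const_mul _).add
    (integrable_finsetSum _ fun d _ => (int_PP A B L _ d).const_mul _)

lemma integral_XX (A B : ℝ) (hA : 1 < A) (hAB : A ≤ B) (L : ℕ) (hL : 1 ≤ A ^ L * (A - 1)) :
    ∃ C : ℝ, 0 ≤ C ∧ ∀ j, ∫ y in Set.Ico A B, XX A L j y ≤ C * (1 / 2) ^ j := by
  set C1 := 4 * (B + 1) * (2 * (1 - A⁻¹)⁻¹) with hC1
  have hq : 0 < 1 - A⁻¹ := sub_pos.2 (inv_lt_one_of_one_lt₀ hA)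
  have hC10 : 0 ≤ C1 := mul_nonneg (by linarith) (by positivity)
  refine ⟨9 * C1 + 4 * (B - 1), by linarith, fun j => ?_⟩
  unfold XX
  rw [integral_add (integrable_finsetSum _ fun d _ => (int_VV A B _ d).const_mul _)
    (integrable_finsetSum _ fun d _ => (int_PP A B L _ d).const_mul _),
    integral_finsetSum _ (fun d _ => (int_VV A B _ d).const_mul _),
    integral_finsetSum _ (fun d _ => (int_PP A B L _ d).const_mul _)]
  simp only [integral_const_mul]
  set R : ℝ := 2 ^ j with hR
  have hK : (16:ℝ) ^ j = R ^ 4 := by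
    rw [hR, show (16:ℝ) = 2 ^ 4 by norm_num, ← pow_mul, ← pow_mul]; congr 1; ring
  have hR1 : 1 ≤ R := one_le_pow₀ (by norm_num)
  have hR0 : 0 < R := by linarith
  have hhalf : ((1:ℝ)/2) ^ j = 1 / R := by rw [hR, one_div_pow]
  rw [hhalf]
  have h1 : ∑ d ∈ Finset.Icc (1:ℕ) ((16 ^ j) ^ 2), (1 / (R ^ 3 * 16 ^ j) * (1 / (d:ℝ))) *
      ∫ y in Set.Ico A B, VV (16 ^ j) d y ≤ 9 * C1 * (1 / R) := by
    calc _ ≤ ∑ d ∈ Finset.Icc (1:ℕ) ((16 ^ j) ^ 2), (C1 / R ^ 3) * (1 / (d:ℝ)) := by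
          refine Finset.sum_le_sum fun d hd => ?_
          have := integral_VV A B hA hAB (16 ^ j) d (Finset.mem_Icc.1 hd).1
          rw [← hC1] at this
          refine (mul_le_mul_of_nonneg_left this (by positivity)).trans (le_of_eq ?_)
          push_cast
          field_simp
      _ ≤ (C1 / R ^ 3) * (9 * R) := by
          rw [← Finset.mul_sum]
          exact mul_le_mul_of_nonneg_left (harm_R j) (by positivity)
      _ = 9 * C1 * (1 / R ^ 2) := by field_simp
      _ ≤ 9 * C1 * (1 / R) := by
          gcongr
          nlinarith
  have h2 : ∑ d ∈ Finset.Ioc ((16 ^ j) ^ 2) ⌊A ^ (16 ^ j)⌋₊, (1 / 16 ^ j * (1 / (d:ℝ))) *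
      ∫ y in Set.Ico A B, PP L (16 ^ j) d y ≤ 4 * (B - 1) * (1 / R) := by
    have hB : 0 ≤ B - 1 := by linarith
    calc _ ≤ ∑ d ∈ Finset.Ioc ((16 ^ j) ^ 2) ⌊A ^ (16 ^ j)⌋₊, (2 * (B - 1) * 16 ^ j) * ((d:ℝ) ^ 2)⁻¹ := by
          refine Finset.sum_le_sum fun d hd => ?_
          have hd1 : 1 ≤ d := by have := (Finset.mem_Ioc.1 hd).1; omega
          have hd0 : (0:ℝ) < d := by exact_mod_cast hd1
          have := integral_PP A B hA hAB L hL (16 ^ j) d hd1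
          refine (mul_le_mul_of_nonneg_left this (by positivity)).trans (le_of_eq ?_)
          push_cast
          field_simp
      _ ≤ (2 * (B - 1) * 16 ^ j) * (2 / (((16 ^ j) ^ 2 : ℕ) + 1)) := by
          rw [← Finset.mul_sum]
          refine mul_le_mul_of_nonneg_left ?_ (by positivity)
          have := sum_Ioo_inv_sq_le (α := ℝ) ((16 ^ j) ^ 2) (⌊A ^ (16 ^ j)⌋₊ + 1)
          refine le_trans (le_of_eq ?_) this
          congr 1
          ext; simp
      _ ≤ (2 * (B - 1) * 16 ^ j) * (2 / (R * 16 ^ j)) := by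
          refine mul_le_mul_of_nonneg_left ?_ (by positivity)
          push_cast
          rw [hK]
          gcongr
          have : R * R ^ 4 ≤ (R ^ 4) ^ 2 := by
            calc R * R ^ 4 = R ^ 5 := by ring
              _ ≤ R ^ 8 := pow_le_pow_right₀ hR1 (by norm_num)
              _ = _ := by ring
          linarith
      _ = _ := by field_simp; ring
  linarith

lemma cnt_le (A : ℝ) (hA : 1 < A) (y : ℝ) (hy : A ≤ y) (N K d a : ℕ) (hN : 1 ≤ N)
    (hK : Real.log N / Real.log A ≤ K) : cnt N d a y ≤ nn K d a y := by
  unfold cnt nn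
  rw [← Nat.card_eq_finsetCard]
  apply Nat.card_mono (Finset.finite_toSet _)
  rintro k ⟨h1, h2, h3⟩
  simp only [Finset.coe_filter, Finset.mem_Icc]
  refine ⟨⟨h1, ?_⟩, h3⟩
  have hlA : 0 < Real.log A := Real.log_pos hA
  have hle : Real.log A ≤ Real.log y := Real.log_le_log (by linarith) hy
  have : Real.log N / Real.log y ≤ Real.log N / Real.log A :=
    div_le_div_of_nonneg_left (Real.log_nonneg (by exact_mod_cast hN)) hlA hle
  exact_mod_cast h2.trans (this.trans hK)

lemma sup_le_real (N d : ℕ) (y M : ℝ) (hM : 0 ≤ M) (h : ∀ a, (cnt N d a y : ℝ) ≤ M) :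
    (((Finset.Icc 1 d).sup (fun a => cnt N d a y) : ℕ) : ℝ) ≤ M := by
  rcases (Finset.Icc 1 d).eq_empty_or_nonempty with he | he
  · rw [he]; simpa using hM
  · obtain ⟨a, _, ha⟩ := Finset.exists_mem_eq_sup _ he (fun a => cnt N d a y)
    rw [ha]; exact h a

lemma fN_le (A : ℝ) (hA : 1 < A) (L : ℕ) (y : ℝ) (hy : A ≤ y) (N j : ℕ) (hN : 1 ≤ N)
    (hK : Real.log N / Real.log A ≤ 16 ^ j) :
    fN N y ≤ (11 + (L + 1) * (1 + Real.log A) + XX A L j y) * 16 ^ j := by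
  set R : ℝ := 2 ^ j with hR
  have hKR : (16:ℝ) ^ j = R ^ 4 := by
    rw [hR, show (16:ℝ) = 2 ^ 4 by norm_num, ← pow_mul, ← pow_mul]; congr 1; ring
  have hR1 : 1 ≤ R := one_le_pow₀ (by norm_num)
  have hR0 : 0 < R := by linarith
  have hlA : 0 < Real.log A := Real.log_pos hA
  have hK' : Real.log N / Real.log A ≤ ((16 ^ j : ℕ) : ℝ) := by exact_mod_cast hK
  have hN0 : (0:ℝ) < N := by exact_mod_cast hN
  set D := ⌊A ^ (16 ^ j)⌋₊ with hD
  have hND : N ≤ D := by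
    refine Nat.le_floor ?_
    rw [div_le_iff₀ hlA] at hK'
    rw [← Real.log_pow] at hK'
    exact (Real.log_le_log_iff hN0 (by positivity)).1 hK'
  have hD1 : 1 ≤ D := hN.trans hND
  have hDlog : Real.log D ≤ 16 ^ j * Real.log A := by
    have : (D:ℝ) ≤ A ^ (16 ^ j) := Nat.floor_le (by positivity)
    have := Real.log_le_log (by exact_mod_cast hD1) this
    rw [Real.log_pow] at this
    exact_mod_cast this
  have hc : ∀ d a, (cnt N d a y : ℝ) ≤ nn (16 ^ j) d a y := fun d a => by
    exact_mod_cast cnt_le A hA y hy N (16 ^ j) d a hN hK'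
  set M : ℕ → ℝ := fun d => (((Finset.Icc 1 d).sup (fun a => cnt N d a y) : ℕ) : ℝ) with hM
  have hM0 : ∀ d, 0 ≤ M d := fun d => by positivity
  have hM1 : ∀ d, 1 ≤ d → M d ≤ 16 ^ j / d + R ^ 3 + VV (16 ^ j) d y / R ^ 3 := by
    intro d hd
    have hV := VV_nonneg (16 ^ j) d hd y
    refine sup_le_real N d y _ (by positivity) fun a => (hc d a).trans ?_
    have h := nn_sq (16 ^ j) d a hd y
    push_cast at h
    set t := (nn (16 ^ j) d a y : ℝ) - 16 ^ j / d with ht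
    have h2 : t ≤ R ^ 3 + VV (16 ^ j) d y / R ^ 3 := by
      have h3 : t ≤ R ^ 3 + t ^ 2 / R ^ 3 := by
        rw [← sub_nonneg]
        have : R ^ 3 + t ^ 2 / R ^ 3 - t = ((R ^ 3 - t / 2) ^ 2 + 3 / 4 * t ^ 2) / R ^ 3 := by
          field_simp; ring
        rw [this]; positivity
      have : t ^ 2 / R ^ 3 ≤ VV (16 ^ j) d y / R ^ 3 := by gcongr
      linarith
    linarith
  have hM2 : ∀ d, M d ≤ L + 1 + PP L (16 ^ j) d y := by
    intro d
    have hP := PP_nonneg L (16 ^ j) d y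
    exact sup_le_real N d y _ (by positivity) fun a => (hc d a).trans (nn_le L _ d a y)
  have hsplit : fN N y ≤ ∑ d ∈ Finset.Icc (1:ℕ) ((16 ^ j) ^ 2), (1 / (d:ℝ)) * M d +
      ∑ d ∈ Finset.Ioc ((16 ^ j) ^ 2) D, (1 / (d:ℝ)) * M d := by
    rw [← Finset.sum_union]
    · unfold fN
      refine Finset.sum_le_sum_of_subset_of_nonneg ?_ (fun d _ _ => mul_nonneg (by positivity) (hM0 d))
      intro d hd
      simp only [Finset.mem_union, Finset.mem_Icc, Finset.mem_Ioc] at hd ⊢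
      omega
    · rw [Finset.disjoint_left]
      intro d h1 h2
      simp only [Finset.mem_Icc, Finset.mem_Ioc] at h1 h2
      omega
  have hs1 : ∑ d ∈ Finset.Icc (1:ℕ) ((16 ^ j) ^ 2), (1 / (d:ℝ)) * M d ≤ 16 ^ j * 2 + R ^ 3 * (9 * R) +
      16 ^ j * ∑ d ∈ Finset.Icc (1:ℕ) ((16 ^ j) ^ 2), (1 / (R ^ 3 * 16 ^ j) * (1 / (d:ℝ))) * VV (16 ^ j) d y := by
    calc _ ≤ ∑ d ∈ Finset.Icc (1:ℕ) ((16 ^ j) ^ 2), (16 ^ j * (1 / (d:ℝ) ^ 2) + R ^ 3 * (1 / (d:ℝ)) +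
          16 ^ j * ((1 / (R ^ 3 * 16 ^ j) * (1 / (d:ℝ))) * VV (16 ^ j) d y)) := by
          refine Finset.sum_le_sum fun d hd => ?_
          have hd1 := (Finset.mem_Icc.1 hd).1
          have hd0 : (0:ℝ) < d := by exact_mod_cast hd1
          refine (mul_le_mul_of_nonneg_left (hM1 d hd1) (by positivity)).trans (le_of_eq ?_)
          field_simp
      _ ≤ _ := by
          rw [Finset.sum_add_distrib, Finset.sum_add_distrib, ← Finset.mul_sum, ← Finset.mul_sum,
            ← Finset.mul_sum]
          gcongr
          · exact sq_sum_le _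
          · exact harm_R j
  have hs2 : ∑ d ∈ Finset.Ioc ((16 ^ j) ^ 2) D, (1 / (d:ℝ)) * M d ≤
      (L + 1) * (1 + Real.log D) +
      16 ^ j * ∑ d ∈ Finset.Ioc ((16 ^ j) ^ 2) D, (1 / 16 ^ j * (1 / (d:ℝ))) * PP L (16 ^ j) d y := by
    calc _ ≤ ∑ d ∈ Finset.Ioc ((16 ^ j) ^ 2) D, ((L + 1) * (1 / (d:ℝ)) +
          16 ^ j * ((1 / 16 ^ j * (1 / (d:ℝ))) * PP L (16 ^ j) d y)) := by
          refine Finset.sum_le_sum fun d hd => ?_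
          have hd1 : 1 ≤ d := by have := (Finset.mem_Ioc.1 hd).1; omega
          have hd0 : (0:ℝ) < d := by exact_mod_cast hd1
          refine (mul_le_mul_of_nonneg_left (hM2 d) (by positivity)).trans (le_of_eq ?_)
          field_simp
      _ ≤ _ := by
          rw [Finset.sum_add_distrib, ← Finset.mul_sum, ← Finset.mul_sum]
          gcongr
          refine le_trans (Finset.sum_le_sum_of_subset_of_nonneg ?_ (fun _ _ _ => by positivity)) (harm_le D)
          intro d hd
          simp only [Finset.mem_Icc, Finset.mem_Ioc] at hd ⊢
          omega
  have hL : ((L:ℝ) + 1) * (1 + Real.log D) ≤ (L + 1) * ((1 + Real.log A) * 16 ^ j) := by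
    refine mul_le_mul_of_nonneg_left ?_ (by positivity)
    have : (1:ℝ) ≤ 16 ^ j := one_le_pow₀ (by norm_num)
    nlinarith
  have hX : XX A L j y =
    ∑ d ∈ Finset.Icc (1:ℕ) ((16 ^ j) ^ 2), (1 / (R ^ 3 * 16 ^ j) * (1 / (d:ℝ))) * VV (16 ^ j) d y +
    ∑ d ∈ Finset.Ioc ((16 ^ j) ^ 2) D, (1 / 16 ^ j * (1 / (d:ℝ))) * PP L (16 ^ j) d y := rfl
  rw [hX]
  have h9 : R ^ 3 * (9 * R) = 9 * 16 ^ j := by rw [hKR]; ring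
  rw [h9] at hs1
  linarith

lemma f_lt_top (A : ℝ) (hA : 1 < A) (L : ℕ) (y : ℝ) (hy : A ≤ y) (M : ℝ)
    (hM : ∀ j, XX A L j y ≤ M) : f y < ⊤ := by
  have hlA : 0 < Real.log A := Real.log_pos hA
  have hM0 : 0 ≤ M := (XX_nonneg A L 0 y).trans (hM 0)
  set Q := (11 + (L + 1) * (1 + Real.log A) + M) * (16 / Real.log A) with hQ
  refine lt_of_le_of_lt (Filter.limsup_le_of_le (a := ENNReal.ofReal Q) (by isBoundedDefault) ?_) ENNReal.ofReal_lt_top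
  filter_upwards [Filter.eventually_ge_atTop ⌈A⌉₊] with N hN
  apply ENNReal.ofReal_le_ofReal
  have hNA : A ≤ N := Nat.ceil_le.1 hN
  have hlog : Real.log A ≤ Real.log N := Real.log_le_log (by linarith) hNA
  obtain ⟨n, hn1, hn2⟩ := exists_nat_pow_near (show 1 ≤ Real.log N / Real.log A from (one_le_div hlA).2 hlog)
    (show (1:ℝ) < 16 by norm_num)
  have hN1 : 1 ≤ N := by
    have : (1:ℝ) ≤ N := by linarith
    exact_mod_cast this
  have h1 := fN_le A hA L y hy N (n+1) hN1 hn2.le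
  rw [div_le_iff₀ (by linarith)]
  refine h1.trans ?_
  have h2 : (16:ℝ) ^ (n+1) ≤ 16 / Real.log A * Real.log N := by
    rw [pow_succ]
    calc (16:ℝ)^n * 16 ≤ Real.log N / Real.log A * 16 := by gcongr
      _ = _ := by ring
  rw [hQ, mul_assoc]
  have h3 := hM (n+1)
  have h4 := XX_nonneg A L (n+1) y
  exact mul_le_mul (by linarith) h2 (by positivity) (by positivity)

lemma ae_f (A B : ℝ) (hA : 1 < A) (hAB : A ≤ B) :
    ∀ᵐ y ∂(volume.restrict (Set.Ico A B)), f y < ⊤ := by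
  obtain ⟨L, hL⟩ : ∃ L : ℕ, 1 ≤ A ^ L * (A - 1) := by
    obtain ⟨L, hL⟩ := pow_unbounded_of_one_lt (1 / (A - 1)) hA
    refine ⟨L, ?_⟩
    rw [div_lt_iff₀ (by linarith)] at hL
    exact hL.le
  obtain ⟨C, hC0, hC⟩ := integral_XX A B hA hAB L hL
  have hmeas : ∀ j, AEMeasurable (fun y => ENNReal.ofReal (XX A L j y)) (volume.restrict (Set.Ico A B)) :=
    fun j => (int_XX A B L j).aemeasurable.ennreal_ofReal
  have hfin : ∫⁻ y in Set.Ico A B, ∑' j, ENNReal.ofReal (XX A L j y) ≠ ⊤ := by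
    rw [lintegral_tsum hmeas]
    have hs : Summable fun j : ℕ => C * (1/2:ℝ) ^ j :=
      (summable_geometric_of_lt_one (by norm_num) (by norm_num)).mul_left C
    refine ne_top_of_le_ne_top hs.tsum_ofReal_ne_top (ENNReal.tsum_le_tsum fun j => ?_)
    rw [← ofReal_integral_eq_lintegral_ofReal (int_XX A B L j) (Filter.Eventually.of_forall fun y => XX_nonneg A L j y)]
    exact ENNReal.ofReal_le_ofReal (hC j)
  have hae := ae_lt_top' (AEMeasurable.ennreal_tsum hmeas) hfin
  filter_upwards [hae, ae_restrict_mem measurableSet_Ico] with y hy hyI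
  refine f_lt_top A hA L y hyI.1 (∑' j, ENNReal.ofReal (XX A L j y)).toReal fun j => ?_
  rw [← ENNReal.ofReal_le_iff_le_toReal hy.ne]
  exact ENNReal.le_tsum (f := fun j => ENNReal.ofReal (XX A L j y)) j

/-- The set `ℰ = {y > 1 : limsup_{N→∞} fN N y / log N = ∞}` is Lebesgue measurable
and has Lebesgue measure zero. -/
theorem stmt10 :
    NullMeasurableSet {y : ℝ | 1 < y ∧ f y = ⊤} volume ∧
      volume {y : ℝ | 1 < y ∧ f y = ⊤} = 0 := by
  have h0 : volume {y : ℝ | 1 < y ∧ f y = ⊤} = 0 := by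
    have hsub : {y : ℝ | 1 < y ∧ f y = ⊤} ⊆
        ⋃ n : ℕ, {y : ℝ | ¬ f y < ⊤} ∩ Set.Ico (1 + 1 / ((n:ℝ) + 1)) (n + 3) := by
      rintro y ⟨hy, hf⟩
      obtain ⟨n, hn⟩ := exists_nat_one_div_lt (sub_pos.2 hy)
      obtain ⟨m, hm⟩ := exists_nat_gt y
      refine Set.mem_iUnion.2 ⟨max n m, ?_, ?_, ?_⟩
      · show ¬ f y < ⊤
        rw [hf]; simp
      · have h1 : (n:ℝ) ≤ (max n m : ℕ) := by exact_mod_cast le_max_left n m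
        have : 1 / (((max n m : ℕ):ℝ) + 1) ≤ 1 / ((n:ℝ) + 1) := by gcongr
        linarith
      · have h1 : (m:ℝ) ≤ (max n m : ℕ) := by exact_mod_cast le_max_right n m
        linarith
    refine measure_mono_null hsub (measure_iUnion_null fun n => ?_)
    have hle : (1:ℝ) / ((n:ℝ) + 1) ≤ 1 := by
      rw [div_le_one (by positivity)]; linarith [Nat.cast_nonneg (α := ℝ) n]
    have := ae_f (1 + 1 / ((n:ℝ) + 1)) (n + 3) (by
      have : (0:ℝ) < 1 / ((n:ℝ) + 1) := by positivity
      linarith) (by linarith [Nat.cast_nonneg (α := ℝ) n])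
    rw [ae_iff, Measure.restrict_apply' measurableSet_Ico] at this
    exact this
  exact ⟨NullMeasurableSet.of_null h0, h0⟩
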